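/- For every real number a > 0 with sinh(a) < 1, sinh(a/4) > (3/16)·sinh(a). -/

import Mathlib

/-- Half-angle estimate: for `s > 0` with `sinh s < 1`, `sinh (s/2) > (√3/4) sinh s`. -/
theorem sinh_half_gt (s : ℝ) (hs : 0 < s) (h : Real.sinh s < 1) :
    √3 / 4 * Real.sinh s < Real.sinh (s / 2) := by
  have hu : 0 < Real.sinh (s / 2) := Real.sinh_pos_iff.mpr (by linarith)
  have hc : 0 < Real.cosh (s / 2) := Real.cosh_pos _
  have hsq := Real.cosh_sq (s / 2)
  have hdouble : Real.sinh s = 2 * Real.sinh (s / 2) * Real.cosh (s / 2) := by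
    rw [← Real.sinh_two_mul, mul_div_cancel₀ s two_ne_zero]
  rw [hdouble] at h ⊢
  set u := Real.sinh (s / 2)
  set c := Real.cosh (s / 2)
  have hprod : (2 * u * c) ^ 2 < 1 := pow_lt_one₀ (by positivity) h two_ne_zero
  rw [mul_pow, hsq] at hprod
  have hu2 : u ^ 2 < 1 / 3 := by nlinarith
  have hlt : √3 * c < 2 := by
    refine lt_of_pow_lt_pow_left₀ 2 two_pos.le ?_
    rw [mul_pow, Real.sq_sqrt (by norm_num), hsq]
    linarith
  nlinarith [mul_lt_mul_of_pos_left hlt hu]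

/-- Quarter-angle estimate: for `a > 0` with `sinh a < 1`, `sinh (a/4) > (3/16) sinh a`. -/
theorem sinh_quarter_gt (a : ℝ) (ha : 0 < a) (hs : Real.sinh a < 1) :
    3 / 16 * Real.sinh a < Real.sinh (a / 4) := by
  have h₁ := sinh_half_gt a ha hs
  have hhalf : Real.sinh (a / 2) < 1 :=
    (Real.sinh_lt_sinh.mpr (half_lt_self ha)).trans hs
  have h₂ := sinh_half_gt (a / 2) (half_pos ha) hhalf
  rw [show a / 2 / 2 = a / 4 by ring] at h₂
  calc 3 / 16 * Real.sinh a = √3 / 4 * (√3 / 4 * Real.sinh a) := by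
        linear_combination -(Real.sinh a / 16) * Real.sq_sqrt (show (0 : ℝ) ≤ 3 by norm_num)
    _ < √3 / 4 * Real.sinh (a / 2) := by gcongr
    _ < Real.sinh (a / 4) := h₂
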